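/- arXiv:2404.09501 — 4 statements merged into one kernel-verified Lean document; each statement's English description precedes it below -/
import Mathlib

section
/- Let N ≥ 2, 1 < p < N, p < q < ∞, p* := Np/(N−p), r > max(q, p*), and let a : ℤ^N → [0,∞) satisfy a(x) → +∞ as |x| → ∞. For each t > 0 suppose u_t : ℤ^N → ℝ and λ_t > 0 satisfy: u_t(x) > 0 for all x, Σ_{x∈ℤ^N} |u_t(x)|^r = rt, ρ(∇u_t) < ∞, I(u_t) = S_t, and the identity ∫_E |∇u_t|^p dw + ∫_E a(x)|∇u_t|^q dw = λ_t · rt. Then λ_t → 0 as t → +∞ and λ_t → +∞ as t → 0⁺. -/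
open Filter Topology
open scoped ENNReal Classical

noncomputable section

abbrev ZN (N : ℕ) := Fin N → ℤ

def adj {N : ℕ} (x y : ZN N) : Prop := (∑ i, (x i - y i).natAbs) = 1

def eInt {N : ℕ} (g : ZN N → ZN N → ℝ) : ℝ≥0∞ :=
  (∑' e : ZN N × ZN N, if adj e.1 e.2 then ENNReal.ofReal (g e.1 e.2) else 0) / 2

def grad {N : ℕ} (u : ZN N → ℝ) (x y : ZN N) : ℝ := u y - u x

def energy {N : ℕ} (p q : ℝ) (a u : ZN N → ℝ) : ℝ≥0∞ :=
  eInt (fun x y => (1 / p) * |grad u x y| ^ p + (a x / q) * |grad u x y| ^ q)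

def gradModular {N : ℕ} (p q : ℝ) (a u : ZN N → ℝ) : ℝ≥0∞ :=
  eInt (fun x y => |grad u x y| ^ p + a x * |grad u x y| ^ q)

def vsum {N : ℕ} (r : ℝ) (u : ZN N → ℝ) : ℝ≥0∞ :=
  ∑' x : ZN N, ENNReal.ofReal (|u x| ^ r)

def Slevel {N : ℕ} (p q : ℝ) (a : ZN N → ℝ) (r t : ℝ) : ℝ≥0∞ :=
  sInf { c : ℝ≥0∞ | ∃ u : ZN N → ℝ, (Function.support u).Finite ∧
      vsum r u = ENNReal.ofReal (r * t) ∧ energy p q a u = c }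

def Lop {N : ℕ} (p q : ℝ) (a u : ZN N → ℝ) (x₀ : ZN N) : ℝ :=
  -(∑' y : ZN N, if adj x₀ y then |u y - u x₀| ^ (p - 2) * (u y - u x₀) else 0)
    - ∑' y : ZN N, if adj x₀ y then
        ((a x₀ + a y) / 2) * (|u y - u x₀| ^ (q - 2) * (u y - u x₀)) else 0

open Function MeasureTheory

/-! ### A discrete Gagliardo–Nirenberg inequality -/

/-- A finitely supported function on `ℤ` is bounded by its total variation. -/
lemma ofReal_abs_le_tsum_abs_sub (w : ℤ → ℝ) (hw : (support w).Finite) (m : ℤ) :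
    ENNReal.ofReal |w m| ≤ ∑' k : ℤ, ENNReal.ofReal |w (k + 1) - w k| := by
  have hinj : Injective fun n : ℕ => m + (n : ℤ) := fun a b hab => by simpa using hab
  obtain ⟨n, hn⟩ : ∃ n : ℕ, w (m + n) = 0 := by
    by_contra! hcon
    exact Set.infinite_of_injective_forall_mem hinj (s := support w) hcon hw
  have htel : w m = -∑ j ∈ Finset.range n, (w (m + j + 1) - w (m + j)) := by
    have := Finset.sum_range_sub (fun j : ℕ => w (m + j)) n
    simp only [Nat.cast_add, Nat.cast_one, Nat.cast_zero, add_zero, ← add_assoc, hn] at this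
    linarith
  calc ENNReal.ofReal |w m|
      ≤ ENNReal.ofReal (∑ j ∈ Finset.range n, |w (m + j + 1) - w (m + j)|) := by
        refine ENNReal.ofReal_le_ofReal ?_
        rw [htel, abs_neg]
        exact Finset.abs_sum_le_sum_abs _ _
    _ = ∑ j ∈ Finset.range n, ENNReal.ofReal |w (m + j + 1) - w (m + j)| :=
        ENNReal.ofReal_sum_of_nonneg fun _ _ => abs_nonneg _
    _ ≤ ∑' j : ℕ, ENNReal.ofReal |w (m + j + 1) - w (m + j)| := ENNReal.sum_le_tsum _
    _ ≤ _ := ENNReal.tsum_comp_le_tsum_of_injective hinj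
        (fun k => ENNReal.ofReal |w (k + 1) - w k|)

lemma lintegral_pi_count_eq_tsum {N : ℕ} (f : ZN N → ℝ≥0∞) :
    ∫⁻ x, f x ∂(Measure.pi fun _ : Fin N => (Measure.count : Measure ℤ)) = ∑' x, f x := by
  rw [lintegral_countable']
  simp [Measure.pi_singleton]

/-- The discrete Gagliardo–Nirenberg inequality with exponent one. -/
lemma tsum_rpow_le_tsum_abs_sub_rpow {N : ℕ} (hN : 2 ≤ N) (v : ZN N → ℝ)
    (hv : (support v).Finite) :
    ∑' x, ENNReal.ofReal |v x| ^ ((N : ℝ) / (N - 1)) ≤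
      (∑' x, ∑ i, ENNReal.ofReal |v (x + Pi.single i 1) - v x|) ^ ((N : ℝ) / (N - 1)) := by
  have hN' : (2 : ℝ) ≤ N := by exact_mod_cast hN
  have hconj : Real.HolderConjugate (Fintype.card (Fin N)) ((N : ℝ) / (N - 1)) := by
    rw [Fintype.card_fin]
    exact Real.HolderConjugate.conjExponent (by linarith)
  set f : ZN N → ℝ≥0∞ := fun x => ∑ i, ENNReal.ofReal |v (x + Pi.single i 1) - v x| with hf
  have key := lintegral_prod_lintegral_pow_le
    (fun _ : Fin N => (Measure.count : Measure ℤ)) hconj (f := f) (measurable_of_countable f)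
  simp only [lintegral_pi_count_eq_tsum, lintegral_count, Fintype.card_fin] at key
  refine le_trans (ENNReal.tsum_le_tsum fun x => ?_) key
  have hline (i : Fin N) : ENNReal.ofReal |v x| ≤ ∑' k : ℤ, f (update x i k) := by
    have hfin : (support fun k : ℤ => v (update x i k)).Finite :=
      hv.preimage (update_injective x i).injOn
    have h1 := ofReal_abs_le_tsum_abs_sub (fun k => v (update x i k)) hfin (x i)
    simp only [update_eq_self] at h1
    refine h1.trans (ENNReal.tsum_le_tsum fun k => ?_)
    have hupd : update x i (k + 1) = update x i k + Pi.single i 1 := by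
      ext j
      by_cases hj : j = i
      · subst hj; simp
      · simp [hj]
    rw [hupd]
    exact Finset.single_le_sum
      (f := fun i' => ENNReal.ofReal |v (update x i k + Pi.single i' 1) - v (update x i k)|)
      (fun _ _ => zero_le) (Finset.mem_univ i)
  calc ENNReal.ofReal |v x| ^ ((N : ℝ) / (N - 1))
      = ∏ _i : Fin N, ENNReal.ofReal |v x| ^ ((1 : ℝ) / (N - 1)) := by
        rw [Finset.prod_const, Finset.card_univ, Fintype.card_fin, ← ENNReal.rpow_mul_natCast]
        congr 1
        ring
    _ ≤ _ := Finset.prod_le_prod' fun i _ =>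
        ENNReal.rpow_le_rpow (hline i) (by have : (0 : ℝ) < N - 1 := by linarith
                                           positivity)

/-! ### Comparing power differences with the energy -/

lemma rpow_sub_rpow_le {A B γ : ℝ} (hA : 0 ≤ A) (hB : 0 < B) (hγ : 1 ≤ γ) :
    B ^ γ - A ^ γ ≤ γ * (B ^ (γ - 1) * (B - A)) := by
  have hbern := one_add_mul_self_le_rpow_one_add (s := A / B - 1)
    (by have := div_nonneg hA hB.le; linarith) hγ
  rw [add_sub_cancel, Real.div_rpow hA hB.le, le_div_iff₀ (Real.rpow_pos_of_pos hB γ)] at hbern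
  have hpow : B ^ γ = B ^ (γ - 1) * B := by
    rw [← Real.rpow_add_one hB.ne', sub_add_cancel]
  have : (1 + γ * (A / B - 1)) * B ^ γ = B ^ γ - γ * (B ^ (γ - 1) * (B - A)) := by
    rw [hpow]; field_simp; ring
  linarith

lemma abs_rpow_sub_rpow_le {A B γ p r : ℝ} (hA : 0 ≤ A) (hB : 0 ≤ B) (hA1 : A ≤ 1) (hB1 : B ≤ 1)
    (hγ : 1 ≤ γ) (hp : 1 < p) (hrγ : r * (p - 1) ≤ (γ - 1) * p) :
    |B ^ γ - A ^ γ| ≤ γ * (A ^ r + B ^ r + |B - A| ^ p) := by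
  wlog hAB : A ≤ B generalizing A B
  · have := this hB hA hB1 hA1 (le_of_not_ge hAB)
    rw [abs_sub_comm, abs_sub_comm B A, add_comm (A ^ r)]
    exact this
  rcases hB.eq_or_lt with rfl | hB0
  · obtain rfl : A = 0 := le_antisymm hAB hA
    simp only [sub_self, abs_zero]
    positivity
  have hmono : A ^ γ ≤ B ^ γ := Real.rpow_le_rpow hA hAB (by linarith)
  rw [abs_of_nonneg (sub_nonneg.2 hmono), abs_of_nonneg (sub_nonneg.2 hAB)]
  refine (rpow_sub_rpow_le hA hB0 hγ).trans (mul_le_mul_of_nonneg_left ?_ (by linarith))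
  have hconj : (p / (p - 1)).HolderConjugate p := (Real.HolderConjugate.conjExponent hp).symm
  have hyoung := Real.young_inequality_of_nonneg (Real.rpow_nonneg hB (γ - 1))
    (sub_nonneg.2 hAB) hconj
  have h1 : (B ^ (γ - 1)) ^ (p / (p - 1)) / (p / (p - 1)) ≤ B ^ r := by
    refine (div_le_self (by positivity) hconj.lt.le).trans ?_
    rw [← Real.rpow_mul hB]
    refine Real.rpow_le_rpow_of_exponent_ge hB0 hB1 ?_
    rw [← mul_div_assoc, le_div_iff₀ (by linarith)]
    exact hrγ
  have h2 : (B - A) ^ p / p ≤ (B - A) ^ p :=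
    div_le_self (Real.rpow_nonneg (sub_nonneg.2 hAB) _) hp.le
  have h3 : 0 ≤ A ^ r := Real.rpow_nonneg hA r
  linarith

lemma adj_add_single {N : ℕ} (x : ZN N) (i : Fin N) : adj x (x + Pi.single i 1) := by
  unfold adj
  rw [Finset.sum_eq_single i] <;> simp +contextual

lemma tsum_add_single_le_eInt {N : ℕ} (g : ZN N → ZN N → ℝ) (i : Fin N) :
    ∑' x, ENNReal.ofReal (g x (x + Pi.single i 1)) ≤ 2 * eInt g := by
  rw [eInt, ENNReal.mul_div_cancel (by simp) (by simp)]
  refine le_trans (le_of_eq ?_) (ENNReal.tsum_comp_le_tsum_of_injective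
    (f := fun x : ZN N => (x, x + Pi.single i 1)) (fun x y hxy => congrArg Prod.fst hxy) _)
  simp [adj_add_single]

lemma tsum_abs_sub_abs_rpow_le {N : ℕ} {γ p r : ℝ} (u : ZN N → ℝ) (hu : ∀ x, |u x| ≤ 1)
    (hγ : 1 ≤ γ) (hp : 1 < p) (hrγ : r * (p - 1) ≤ (γ - 1) * p) :
    ∑' x, ∑ i, ENNReal.ofReal |(|u (x + Pi.single i 1)| ^ γ) - |u x| ^ γ| ≤
      N * (ENNReal.ofReal γ * (2 * vsum r u + 2 * eInt fun x y => |grad u x y| ^ p)) := by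
  rw [Summable.tsum_finsetSum fun _ _ => ENNReal.summable]
  refine (Finset.sum_le_card_nsmul _ _
    (ENNReal.ofReal γ * (2 * vsum r u + 2 * eInt fun x y => |grad u x y| ^ p))
    fun i _ => ?_).trans (by simp [nsmul_eq_mul])
  calc ∑' x, ENNReal.ofReal |(|u (x + Pi.single i 1)| ^ γ) - |u x| ^ γ|
      ≤ ∑' x, ENNReal.ofReal γ * (ENNReal.ofReal (|u x| ^ r)
          + ENNReal.ofReal (|u (x + Pi.single i 1)| ^ r)
          + ENNReal.ofReal (|grad u x (x + Pi.single i 1)| ^ p)) := by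
        refine ENNReal.tsum_le_tsum fun x => ?_
        rw [← ENNReal.ofReal_add (by positivity) (by positivity),
          ← ENNReal.ofReal_add (by positivity) (by positivity),
          ← ENNReal.ofReal_mul (by linarith)]
        refine ENNReal.ofReal_le_ofReal
          ((abs_rpow_sub_rpow_le (abs_nonneg _) (abs_nonneg _) (hu _) (hu _) hγ hp hrγ).trans ?_)
        have : |(|u (x + Pi.single i 1)| - |u x|)| ^ p ≤ |grad u x (x + Pi.single i 1)| ^ p :=
          Real.rpow_le_rpow (abs_nonneg _) (abs_abs_sub_abs_le_abs_sub _ _) (by linarith)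
        gcongr
    _ ≤ _ := by
        rw [ENNReal.tsum_mul_left, ENNReal.tsum_add, ENNReal.tsum_add]
        have hshift : ∑' x : ZN N, ENNReal.ofReal (|u (x + Pi.single i 1)| ^ r) = vsum r u :=
          (Equiv.addRight (Pi.single i 1 : ZN N)).tsum_eq fun x => ENNReal.ofReal (|u x| ^ r)
        rw [hshift, two_mul]
        gcongr
        · exact le_rfl
        · exact tsum_add_single_le_eInt (fun x y => |grad u x y| ^ p) i

lemma abs_le_one_of_vsum_le_one {N : ℕ} {r : ℝ} (hr : 0 < r) {u : ZN N → ℝ}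
    (hu : vsum r u ≤ 1) (x : ZN N) : |u x| ≤ 1 := by
  have h1 : ENNReal.ofReal (|u x| ^ r) ≤ 1 :=
    (ENNReal.le_tsum (f := fun x => ENNReal.ofReal (|u x| ^ r)) x).trans hu
  rw [ENNReal.ofReal_le_one] at h1
  by_contra! hcon
  exact absurd h1 (not_le.2 (Real.one_lt_rpow hcon hr))

/-- A Sobolev-type inequality for finitely supported functions of small `ℓ^r` norm. -/
lemma vsum_le_of_vsum_le_one {N : ℕ} (hN : 2 ≤ N) {p r : ℝ} (hp : 1 < p)
    (hpN : p < (N : ℝ)) (hr : (N : ℝ) * p / (N - p) < r) {u : ZN N → ℝ}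
    (hsupp : (support u).Finite) (hu : vsum r u ≤ 1) :
    vsum r u ≤ (N * (ENNReal.ofReal (r * (N - 1) / N) *
      (2 * vsum r u + 2 * eInt fun x y => |grad u x y| ^ p))) ^ ((N : ℝ) / (N - 1)) := by
  have hN' : (2 : ℝ) ≤ N := by exact_mod_cast hN
  have hr' : N * p < r * (N - p) := (div_lt_iff₀ (by linarith)).1 hr
  have hr0 : 0 < r := lt_trans (div_pos (by positivity) (by linarith)) hr
  have hN1 : (0 : ℝ) < N - 1 := by linarith
  set γ : ℝ := r * (N - 1) / N with hγdef
  have hrγ : r * (p - 1) ≤ (γ - 1) * p := by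
    have hγN : γ * N = r * (N - 1) := by rw [hγdef]; field_simp
    have : r * (p - 1) * N ≤ (γ - 1) * p * N := by
      have : (γ - 1) * p * N = (γ * N) * p - p * N := by ring
      rw [this, hγN]; nlinarith
    exact le_of_mul_le_mul_right this (by linarith)
  have hγ : 1 ≤ γ := by
    have : 0 < r * (p - 1) := mul_pos hr0 (by linarith)
    nlinarith
  have hsupp' : (support fun x => |u x| ^ γ).Finite := by
    refine hsupp.subset fun x hx => ?_
    contrapose! hx
    simp only [mem_support, not_not] at hx ⊢
    rw [hx, abs_zero, Real.zero_rpow (by linarith)]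
  refine le_trans (le_of_eq ?_) ((tsum_rpow_le_tsum_abs_sub_rpow hN _ hsupp').trans
    (ENNReal.rpow_le_rpow (tsum_abs_sub_abs_rpow_le u (abs_le_one_of_vsum_le_one hr0 hu)
      hγ hp hrγ) (by positivity)))
  refine tsum_congr fun x => ?_
  rw [abs_of_nonneg (Real.rpow_nonneg (abs_nonneg (u x)) γ),
    ENNReal.ofReal_rpow_of_nonneg (by positivity) (by positivity), ← Real.rpow_mul (abs_nonneg _)]
  congr 2
  rw [hγdef]; field_simp

/-! ### Edge integrals -/

lemma eInt_mono {N : ℕ} {g g' : ZN N → ZN N → ℝ} (hg : ∀ x y, g x y ≤ g' x y) :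
    eInt g ≤ eInt g' := by
  unfold eInt
  gcongr with e
  split_ifs
  · exact ENNReal.ofReal_le_ofReal (hg _ _)
  · exact le_rfl

lemma eInt_const_mul {N : ℕ} {c : ℝ} (hc : 0 ≤ c) (g : ZN N → ZN N → ℝ) :
    eInt (fun x y => c * g x y) = ENNReal.ofReal c * eInt g := by
  simp only [eInt, ENNReal.ofReal_mul hc]
  rw [← mul_div_assoc, ← ENNReal.tsum_mul_left]
  simp only [mul_ite, mul_zero]

lemma eInt_add {N : ℕ} {g g' : ZN N → ZN N → ℝ} (hg : ∀ x y, 0 ≤ g x y)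
    (hg' : ∀ x y, 0 ≤ g' x y) : eInt (fun x y => g x y + g' x y) = eInt g + eInt g' := by
  unfold eInt
  rw [← ENNReal.add_div, ← ENNReal.tsum_add]
  congr 2 with e
  split_ifs
  · exact ENNReal.ofReal_add (hg _ _) (hg' _ _)
  · simp

section energy

variable {N : ℕ} {p q : ℝ} {a : ZN N → ℝ}

lemma eInt_abs_grad_rpow_le_energy (hp : 0 < p) (hq : 0 < q) (ha : ∀ x, 0 ≤ a x) (u : ZN N → ℝ) :
    (eInt fun x y => |grad u x y| ^ p) ≤ ENNReal.ofReal p * energy p q a u := by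
  rw [energy, ← eInt_const_mul hp.le]
  refine eInt_mono fun x y => ?_
  have : 0 ≤ p * (a x / q * |grad u x y| ^ q) := by have := ha x; positivity
  rw [mul_add, ← mul_assoc, mul_one_div_cancel hp.ne', one_mul]
  linarith

lemma energy_le_gradModular (hp : 1 ≤ p) (hq : 1 ≤ q) (ha : ∀ x, 0 ≤ a x) (u : ZN N → ℝ) :
    energy p q a u ≤ gradModular p q a u := by
  refine eInt_mono fun x y => add_le_add ?_ ?_
  · exact mul_le_of_le_one_left (by positivity) ((div_le_one (by linarith)).2 hp)
  · exact mul_le_mul_of_nonneg_right (div_le_self (ha x) hq) (by positivity)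

lemma gradModular_le_energy (hp : 0 < p) (hpq : p ≤ q) (u : ZN N → ℝ) :
    gradModular p q a u ≤ ENNReal.ofReal q * energy p q a u := by
  rw [energy, ← eInt_const_mul (hp.le.trans hpq)]
  refine eInt_mono fun x y => ?_
  have hq : 0 < q := hp.trans_le hpq
  have h1 : |grad u x y| ^ p ≤ q * (1 / p * |grad u x y| ^ p) := by
    rw [← mul_assoc, mul_one_div]
    exact le_mul_of_one_le_left (by positivity) ((one_le_div hp).2 hpq)
  have h2 : q * (a x / q * |grad u x y| ^ q) = a x * |grad u x y| ^ q := by field_simp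
  rw [mul_add, h2]
  linarith

lemma gradModular_eq_add (ha : ∀ x, 0 ≤ a x) (u : ZN N → ℝ) :
    gradModular p q a u = (eInt fun x y => |grad u x y| ^ p) +
      eInt fun x y => a x * |grad u x y| ^ q :=
  eInt_add (fun _ _ => by positivity) fun x _ => mul_nonneg (ha x) (by positivity)

lemma energy_const_mul_le {s : ℝ} (hs : 1 ≤ s) (hp : 0 < p) (hpq : p ≤ q) (u : ZN N → ℝ) :
    energy p q a (fun x => s * u x) ≤ ENNReal.ofReal (s ^ q) * energy p q a u := by
  have hs0 : 0 ≤ s := by linarith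
  have hq : 0 < q := hp.trans_le hpq
  rw [energy, energy, ← eInt_const_mul (by positivity)]
  refine eInt_mono fun x y => ?_
  have hgrad : |grad (fun x => s * u x) x y| = s * |grad u x y| := by
    rw [grad, grad, ← mul_sub, abs_mul, abs_of_nonneg hs0]
  have hsp : s ^ p ≤ s ^ q := Real.rpow_le_rpow_of_exponent_le hs hpq
  rw [hgrad, Real.mul_rpow hs0 (abs_nonneg _), Real.mul_rpow hs0 (abs_nonneg _)]
  have h1 : 1 / p * (s ^ p * |grad u x y| ^ p) ≤ s ^ q * (1 / p * |grad u x y| ^ p) := by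
    rw [mul_left_comm]
    gcongr
  linarith [mul_left_comm (a x / q) (s ^ q) (|grad u x y| ^ q)]

lemma adj.mem_Icc {x y : ZN N} (h : adj x y) : x - y ∈ Set.Icc (-1 : ZN N) 1 := by
  have hi (i : Fin N) : (x i - y i).natAbs ≤ 1 :=
    (Finset.single_le_sum (f := fun i => (x i - y i).natAbs) (fun _ _ => Nat.zero_le _)
      (Finset.mem_univ i)).trans_eq h
  constructor <;> intro i <;> have := hi i <;> simp <;> omega

lemma energy_single_lt_top (hp : 0 < p) (hq : 0 < q) :
    energy p q a (Pi.single 0 1) < ⊤ := by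
  unfold energy eInt
  refine ENNReal.div_lt_top ?_ two_ne_zero
  have hfin : (Set.Icc (-1 : ZN N) 1 ×ˢ Set.Icc (-1 : ZN N) 1).Finite :=
    (Set.finite_Icc _ _).prod (Set.finite_Icc _ _)
  rw [tsum_eq_sum (s := hfin.toFinset)]
  · refine (ENNReal.sum_lt_top.2 fun e _ => ?_).ne
    split_ifs <;> simp
  · rintro ⟨x, y⟩ hxy
    split_ifs with hadj
    · have hIcc := hadj.mem_Icc
      dsimp only at hadj hIcc
      have hz : (0 : ZN N) ∈ Set.Icc (-1 : ZN N) 1 := by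
        constructor <;> intro i <;> simp
      have hx : x ≠ 0 := by
        rintro rfl
        rw [zero_sub] at hIcc
        exact hxy (hfin.mem_toFinset.2 ⟨hz, neg_le.1 hIcc.2, neg_le_neg_iff.1 hIcc.1⟩)
      have hy : y ≠ 0 := by
        rintro rfl
        rw [sub_zero] at hIcc
        exact hxy (hfin.mem_toFinset.2 ⟨hIcc, hz⟩)
      simp [grad, hx, hy, Real.zero_rpow hp.ne', Real.zero_rpow hq.ne']
    · rfl

lemma Slevel_le {r t : ℝ} (hr : 0 < r) (hrt : 1 ≤ r * t) (hp : 0 < p) (hpq : p ≤ q) :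
    Slevel p q a r t ≤
      ENNReal.ofReal ((r * t) ^ (q / r)) * energy p q a (Pi.single 0 1) := by
  have hs : 1 ≤ (r * t) ^ (1 / r) := Real.one_le_rpow hrt (by positivity)
  have hT : 0 ≤ r * t := by linarith
  have hsupp : support (fun x => (r * t) ^ (1 / r) * (Pi.single 0 1 : ZN N → ℝ) x) ⊆ {0} := by
    intro x hx
    contrapose! hx
    simp_all
  refine le_trans (b := energy p q a _)
    (sInf_le ⟨_, (Set.finite_singleton _).subset hsupp, ?_, rfl⟩) ((energy_const_mul_le hs hp hpq _).trans_eq ?_)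
  · rw [vsum, tsum_eq_single 0]
    · rw [Pi.single_eq_same, mul_one, abs_of_nonneg (by linarith), ← Real.rpow_mul hT,
        one_div_mul_cancel hr.ne', Real.rpow_one]
    · intro x hx
      simp [hx, Real.zero_rpow hr.ne']
  · rw [← Real.rpow_mul hT, one_div_mul_eq_div]

lemma le_Slevel {r t : ℝ} (hN : 2 ≤ N) (hp : 1 < p) (hpN : p < (N : ℝ)) (hq : 0 < q)
    (hr : (N : ℝ) * p / (N - p) < r) (ht : 0 < r * t) (ht1 : r * t ≤ 1) (ha : ∀ x, 0 ≤ a x) :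
    ENNReal.ofReal
      (r * t * (((r * t) ^ (-(1 / N) : ℝ) / (2 * N * (r * (N - 1) / N)) - 1) / p)) ≤
      Slevel p q a r t := by
  refine le_sInf ?_
  rintro _ ⟨u, hsupp, hu, rfl⟩
  rcases eq_or_ne (energy p q a u) ⊤ with htop | hfin
  · rw [htop]; exact le_top
  have hN' : (2 : ℝ) ≤ N := by exact_mod_cast hN
  have hN1 : (0 : ℝ) < N - 1 := by linarith
  have hr0 : 0 < r := lt_trans (div_pos (by positivity) (by linarith)) hr
  have hsob := vsum_le_of_vsum_le_one hN hp hpN hr hsupp (by rw [hu]; simpa using ht1)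
  replace hsob := hsob.trans (ENNReal.rpow_le_rpow (mul_le_mul_right (mul_le_mul_right
    (add_le_add_right (mul_le_mul_right
      (eInt_abs_grad_rpow_le_energy (by linarith) hq ha u) _) _) _) _)
    (by positivity))
  rw [hu] at hsob
  lift energy p q a u to NNReal using hfin with e
  have hγ0 : 0 < r * (N - 1) / N := by positivity
  generalize r * (N - 1) / N = γ at *
  generalize r * t = T at *
  have hreal : T ≤ (N * (γ * (2 * T + 2 * (p * e)))) ^ ((N : ℝ) / (N - 1)) := by
    rw [← ENNReal.ofReal_le_ofReal_iff (by positivity)]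
    refine hsob.trans_eq ?_
    rw [← ENNReal.ofReal_rpow_of_nonneg (by positivity) (by positivity),
      ENNReal.ofReal_mul (by positivity), ENNReal.ofReal_mul (by positivity),
      ENNReal.ofReal_add (by positivity) (by positivity), ENNReal.ofReal_mul (by positivity),
      ENNReal.ofReal_mul (by positivity), ENNReal.ofReal_mul (by positivity)]
    simp
  have hroot : T * T ^ (-(1 / N) : ℝ) ≤ N * (γ * (2 * T + 2 * (p * e))) := by
    have h1 := Real.rpow_le_rpow ht.le hreal (z := (N - 1) / N) (by positivity)
    rw [← Real.rpow_mul (by positivity),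
      show (N : ℝ) / (N - 1) * ((N - 1) / N) = 1 by field_simp, Real.rpow_one] at h1
    rw [mul_comm, ← Real.rpow_add_one ht.ne']
    convert h1 using 2
    field_simp
    ring
  rw [← ENNReal.ofReal_coe_nnreal]
  refine ENNReal.ofReal_le_ofReal ?_
  rw [← mul_div_assoc, div_le_iff₀ (by linarith), mul_sub, mul_one, ← mul_div_assoc,
    sub_le_iff_le_add, div_le_iff₀ (by positivity)]
  linarith

end energy

/-- asymptotic behaviour of the Lagrange multipliers `λ_t`:
`λ_t → 0` as `t → ∞` and `λ_t → ∞` as `t → 0⁺`. -/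
theorem statement4 {N : ℕ} (hN : 2 ≤ N) (p q : ℝ) (hp : 1 < p) (hpN : p < (N : ℝ))
    (hpq : p < q) (pstar : ℝ) (hpstar : pstar = (N : ℝ) * p / ((N : ℝ) - p))
    (r : ℝ) (hr : max q pstar < r)
    (a : ZN N → ℝ) (ha : ∀ x, 0 ≤ a x) (hainf : Tendsto a cofinite atTop)
    (u : ℝ → ZN N → ℝ) (lam : ℝ → ℝ)
    (h : ∀ t : ℝ, 0 < t →
      (∀ x, 0 < u t x) ∧
      vsum r (u t) = ENNReal.ofReal (r * t) ∧
      gradModular p q a (u t) < ⊤ ∧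
      energy p q a (u t) = Slevel p q a r t ∧
      0 < lam t ∧
      eInt (fun x' y' => |grad (u t) x' y'| ^ p) +
          eInt (fun x' y' => a x' * |grad (u t) x' y'| ^ q) =
        ENNReal.ofReal (lam t * (r * t))) :
    Tendsto lam atTop (𝓝 0) ∧ Tendsto lam (𝓝[>] (0 : ℝ)) atTop := by
  have hq : 0 < q := by linarith
  have hqr : q < r := (le_max_left _ _).trans_lt hr
  have hr0 : 0 < r := hq.trans hqr
  have hrstar : (N : ℝ) * p / (N - p) < r := hpstar ▸ (le_max_right _ _).trans_lt hr
  have hlam (t : ℝ) (ht : 0 < t) : 0 < lam t ∧ energy p q a (u t) = Slevel p q a r t ∧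
      gradModular p q a (u t) = ENNReal.ofReal (lam t * (r * t)) := by
    obtain ⟨-, -, -, hS, hpos, hsum⟩ := h t ht
    exact ⟨hpos, hS, (gradModular_eq_add ha _).trans hsum⟩
  constructor
  · obtain ⟨K, hK⟩ : ∃ K : NNReal, (K : ℝ≥0∞) = energy p q a (Pi.single 0 1) :=
      ⟨_, ENNReal.coe_toNNReal (energy_single_lt_top (zero_lt_one.trans hp) hq).ne⟩
    have hlim : Tendsto (fun t : ℝ => q * K * (r * t) ^ (-(1 - q / r))) atTop (𝓝 0) := by
      have h1 : 0 < 1 - q / r := sub_pos.2 ((div_lt_one hr0).2 hqr)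
      simpa using ((tendsto_rpow_neg_atTop h1).comp
        (tendsto_id.const_mul_atTop hr0)).const_mul (q * K : ℝ)
    refine tendsto_of_tendsto_of_tendsto_of_le_of_le' tendsto_const_nhds hlim ?_ ?_
    · filter_upwards [eventually_gt_atTop 0] with t ht using (hlam t ht).1.le
    · filter_upwards [eventually_ge_atTop (1 / r), eventually_gt_atTop 0] with t htr ht
      obtain ⟨-, hS, hM⟩ := hlam t ht
      have hT : 1 ≤ r * t := by rwa [div_le_iff₀' hr0] at htr
      have hle := (gradModular_le_energy (a := a) (by linarith) hpq.le (u t)).trans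
        (mul_le_mul_right (hS.trans_le (Slevel_le hr0 hT (by linarith) hpq.le)) _)
      rw [hM, ← hK, ← ENNReal.ofReal_coe_nnreal, ← ENNReal.ofReal_mul (by positivity),
        ← ENNReal.ofReal_mul hq.le, ENNReal.ofReal_le_ofReal_iff (by positivity),
        ← le_div_iff₀ (by linarith)] at hle
      refine hle.trans_eq ?_
      rw [neg_sub, Real.rpow_sub_one (by linarith)]
      ring
  · have hN' : (2 : ℝ) ≤ N := by exact_mod_cast hN
    have hN1 : (0 : ℝ) < N - 1 := by linarith
    have hlim : Tendsto (fun t : ℝ =>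
        ((r * t) ^ (-(1 / N) : ℝ) / (2 * N * (r * (N - 1) / N)) - 1) / p) (𝓝[>] 0) atTop := by
      refine Tendsto.atTop_div_const (by linarith) (tendsto_atTop_add_const_right _ _
        (Tendsto.atTop_div_const (by positivity) ?_))
      have h1 : Tendsto (fun t : ℝ => r * t) (𝓝[>] 0) (𝓝[>] 0) := by
        refine tendsto_nhdsWithin_iff.2 ⟨?_, ?_⟩
        · have : Tendsto (fun t : ℝ => r * t) (𝓝 0) (𝓝 (r * 0)) := tendsto_id.const_mul r
          rw [mul_zero] at this
          exact this.mono_left nhdsWithin_le_nhds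
        · filter_upwards [self_mem_nhdsWithin] with t ht using mul_pos hr0 ht
      exact (tendsto_rpow_neg_nhdsGT_zero (by simp; positivity)).comp h1
    refine tendsto_atTop_mono' _ ?_ hlim
    filter_upwards [Ioo_mem_nhdsGT (one_div_pos.2 hr0)] with t ht
    obtain ⟨hpos, hS, hM⟩ := hlam t ht.1
    have hT : 0 < r * t := mul_pos hr0 ht.1
    have hT1 : r * t ≤ 1 := by
      have := ht.2.le
      rwa [le_div_iff₀' hr0] at this
    have hle := (le_Slevel (q := q) hN hp hpN hq hrstar hT hT1 ha).trans (hS.symm.trans_le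
      (energy_le_gradModular hp.le (by linarith) ha (u t)))
    rw [hM, ENNReal.ofReal_le_ofReal_iff (by positivity), mul_comm (lam t)] at hle
    exact le_of_mul_le_mul_left hle hT
end
end

section
/- Let N ≥ 2, 1 < p < N, p* := Np/(N−p), let q > p* (so q > p), set r := q, and let a : ℤ^N → [0,∞) be bounded. Then lim_{t→+∞} S_t / t = 0. -/
open Filter Topology
open scoped ENNReal Classical

noncomputable section

lemma adj.norm_sub_le {N : ℕ} {x y : ZN N} (h : adj x y) : ‖x - y‖ ≤ 1 := by
  refine (pi_norm_le_iff_of_nonneg zero_le_one).2 fun i => ?_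
  have hi : (x i - y i).natAbs ≤ 1 := by
    unfold adj at h
    rw [← h]
    exact Finset.single_le_sum (f := fun i => (x i - y i).natAbs)
      (fun _ _ => Nat.zero_le _) (Finset.mem_univ i)
  rw [Pi.sub_apply, Int.norm_eq_abs]
  have : |x i - y i| ≤ 1 := by
    rw [Int.abs_eq_natAbs]
    exact_mod_cast hi
  exact_mod_cast this

/-- The box `[-n, n]^N`, that is, the closed ball of radius `n` for the sup norm. -/
def box (N n : ℕ) : Finset (ZN N) := Finset.Icc (fun _ => -(n : ℤ)) (fun _ => (n : ℤ))

lemma mem_box {N n : ℕ} {x : ZN N} : x ∈ box N n ↔ ‖x‖ ≤ n := by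
  rw [pi_norm_le_iff_of_nonneg (Nat.cast_nonneg n), box, Finset.mem_Icc, Pi.le_def, Pi.le_def,
    ← forall_and]
  refine forall_congr' fun i => ?_
  rw [Int.norm_eq_abs, ← abs_le]
  exact_mod_cast Iff.rfl

lemma card_box (N n : ℕ) : (box N n).card = (2 * n + 1) ^ N := by
  rw [box, Pi.card_Icc]
  simp only [Int.card_Icc, Finset.prod_const, Finset.card_univ, Fintype.card_fin]
  congr 1
  omega

lemma tsum_adj_le {N : ℕ} (x : ZN N) (M : ℝ≥0∞) :
    ∑' y : ZN N, (if adj x y then M else 0) ≤ 3 ^ N * M := by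
  have hsub : ∀ y : ZN N, adj x y → x - y ∈ box N 1 := fun y h =>
    mem_box.2 (by simpa using h.norm_sub_le)
  calc ∑' y : ZN N, (if adj x y then M else 0)
      ≤ ∑' y : ZN N, (if x - y ∈ box N 1 then M else 0) := by
        refine ENNReal.tsum_le_tsum fun y => ?_
        by_cases h : adj x y
        · simp [h, hsub y h]
        · simp [h]
    _ = ∑' z : ZN N, (if z ∈ box N 1 then M else 0) :=
        (Equiv.subLeft x).tsum_eq fun z => if z ∈ box N 1 then M else 0
    _ = 3 ^ N * M := by
        rw [tsum_eq_sum (s := box N 1) fun z hz => if_neg hz,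
          Finset.sum_congr rfl fun z hz => if_pos hz, Finset.sum_const, card_box, nsmul_eq_mul]
        norm_num

/-- An edge sum of a function supported over a box and bounded by `M` is controlled by the number
of points of the box. -/
lemma eInt_le_of_box {N n : ℕ} {g : ZN N → ZN N → ℝ} {M : ℝ}
    (hM : ∀ x y, adj x y → g x y ≤ M) (hg : ∀ x y, adj x y → x ∉ box N n → g x y = 0) :
    eInt g ≤ ((2 * n + 1) ^ N * 3 ^ N : ℝ≥0∞) * ENNReal.ofReal M := by
  unfold eInt
  refine ENNReal.half_le_self.trans ?_
  rw [ENNReal.tsum_prod (f := fun x y => if adj x y then ENNReal.ofReal (g x y) else 0)]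
  calc ∑' x : ZN N, ∑' y : ZN N, (if adj x y then ENNReal.ofReal (g x y) else 0)
      ≤ ∑' x : ZN N, (if x ∈ box N n then 3 ^ N * ENNReal.ofReal M else 0) := by
        refine ENNReal.tsum_le_tsum fun x => ?_
        by_cases hx : x ∈ box N n
        · rw [if_pos hx]
          refine le_trans (ENNReal.tsum_le_tsum fun y => ?_) (tsum_adj_le x _)
          split_ifs with h
          · exact ENNReal.ofReal_le_ofReal (hM x y h)
          · exact le_rfl
        · rw [if_neg hx, nonpos_iff_eq_zero, ENNReal.tsum_eq_zero]
          intro y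
          split_ifs with h
          · simp [hg x y h hx]
          · rfl
    _ = ((2 * n + 1) ^ N * 3 ^ N : ℝ≥0∞) * ENNReal.ofReal M := by
        rw [tsum_eq_sum (s := box N n) fun z hz => if_neg hz,
          Finset.sum_congr rfl fun z hz => if_pos hz, Finset.sum_const, card_box, nsmul_eq_mul]
        push_cast
        ring

/-- The tent function of height and radius `n` for the sup norm. -/
def tent (N n : ℕ) (x : ZN N) : ℝ := max 0 (n - ‖x‖)

lemma tent_eq_zero {N n : ℕ} {x : ZN N} (h : (n : ℝ) ≤ ‖x‖) : tent N n x = 0 :=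
  max_eq_left (sub_nonpos.2 h)

lemma abs_tent_sub_le {N n : ℕ} {x y : ZN N} (h : adj x y) : |tent N n y - tent N n x| ≤ 1 := by
  have h1 := abs_max_sub_max_le_abs ((n : ℝ) - ‖y‖) (n - ‖x‖) 0
  have h2 := abs_norm_sub_norm_le x y
  have h3 := h.norm_sub_le
  rw [tent, tent, max_comm 0, max_comm 0]
  refine h1.trans (le_trans (le_of_eq ?_) (h2.trans h3))
  congr 1
  ring

lemma tent_sub_eq_zero {N n : ℕ} {x y : ZN N} (h : adj x y) (hx : x ∉ box N n) :
    tent N n y - tent N n x = 0 := by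
  have hx' : (n : ℝ) < ‖x‖ := not_le.1 fun hle => hx (mem_box.2 hle)
  have hy : (n : ℝ) ≤ ‖y‖ := by
    by_contra hlt
    rw [not_le] at hlt
    refine hx (mem_box.2 ?_)
    rw [pi_norm_le_iff_of_nonneg (Nat.cast_nonneg n)]
    intro i
    have hn : (0 : ℝ) < n := (norm_nonneg y).trans_lt hlt
    have h1 := (pi_norm_lt_iff hn).1 hlt i
    have h2 := (norm_le_pi_norm (x - y) i).trans h.norm_sub_le
    rw [Pi.sub_apply] at h2
    rw [Int.norm_eq_abs] at h1 h2 ⊢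
    have h1' : |y i| < n := by exact_mod_cast h1
    have h2' : |x i - y i| ≤ 1 := by exact_mod_cast h2
    have h3 : |x i| ≤ n := by
      rw [abs_le] at *
      rw [abs_lt] at h1'
      omega
    exact_mod_cast h3
  rw [tent_eq_zero hy, tent_eq_zero hx'.le, sub_zero]

lemma support_tent_subset (N n : ℕ) : Function.support (tent N n) ⊆ box N n := fun _ hx =>
  mem_box.2 (not_lt.1 fun h => hx (tent_eq_zero h.le))

lemma vsum_const_mul {N : ℕ} {r c : ℝ} (hc : 0 ≤ c) (u : ZN N → ℝ) :
    vsum r (fun x => c * u x) = ENNReal.ofReal (c ^ r) * vsum r u := by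
  unfold vsum
  rw [← ENNReal.tsum_mul_left]
  refine tsum_congr fun x => ?_
  rw [abs_mul, abs_of_nonneg hc, Real.mul_rpow hc (abs_nonneg _),
    ENNReal.ofReal_mul (Real.rpow_nonneg hc r)]

lemma vsum_ne_top {N : ℕ} {r : ℝ} (hr : 0 < r) {u : ZN N → ℝ} {s : Finset (ZN N)}
    (hu : Function.support u ⊆ s) : vsum r u ≠ ⊤ := by
  unfold vsum
  rw [tsum_eq_sum (s := s)]
  · exact ENNReal.sum_ne_top.2 fun _ _ => ENNReal.ofReal_ne_top
  · intro x hx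
    have : u x = 0 := by
      by_contra h
      exact hx (hu h)
    simp [this, Real.zero_rpow hr.ne']

lemma le_vsum_tent (N m : ℕ) {r : ℝ} (hr : 0 < r) :
    ENNReal.ofReal ((2 * m + 1) ^ N * (m : ℝ) ^ r) ≤ vsum r (tent N (2 * m)) := by
  calc ENNReal.ofReal ((2 * m + 1) ^ N * (m : ℝ) ^ r)
      = ∑ _x ∈ box N m, ENNReal.ofReal ((m : ℝ) ^ r) := by
        rw [Finset.sum_const, card_box, ENNReal.ofReal_mul (by positivity), nsmul_eq_mul]
        congr 1
        rw [← ENNReal.ofReal_natCast]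
        push_cast
        rfl
    _ ≤ ∑ x ∈ box N m, ENNReal.ofReal (|tent N (2 * m) x| ^ r) := by
        refine Finset.sum_le_sum fun x hx => ENNReal.ofReal_le_ofReal ?_
        refine Real.rpow_le_rpow (Nat.cast_nonneg m) (le_trans ?_ (le_abs_self _)) hr.le
        refine le_trans ?_ (le_max_right _ _)
        have := mem_box.1 hx
        push_cast
        linarith
    _ ≤ vsum r (tent N (2 * m)) := ENNReal.sum_le_tsum _

lemma energy_const_mul_tent_le {N n : ℕ} {p q : ℝ} (hp : 0 < p) (hq : 0 < q) {a : ZN N → ℝ}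
    {A : ℝ} (ha : ∀ x, 0 ≤ a x) (hA : ∀ x, a x ≤ A) {c : ℝ} (hc : 0 ≤ c) :
    energy p q a (fun x => c * tent N n x) ≤
      ((2 * n + 1) ^ N * 3 ^ N : ℝ≥0∞) * ENNReal.ofReal (1 / p * c ^ p + A / q * c ^ q) := by
  have hgrad : ∀ x y : ZN N, grad (fun x => c * tent N n x) x y
      = c * (tent N n y - tent N n x) := fun x y => by rw [grad, mul_sub]
  refine eInt_le_of_box (fun x y h => ?_) (fun x y h hx => ?_)
  · have hle : |grad (fun x => c * tent N n x) x y| ≤ c := by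
      rw [hgrad, abs_mul, abs_of_nonneg hc]
      exact mul_le_of_le_one_right hc (abs_tent_sub_le h)
    have := (ha x).trans (hA x)
    have := hA x
    gcongr
  · rw [hgrad, tent_sub_eq_zero h hx]
    simp [Real.zero_rpow hp.ne', Real.zero_rpow hq.ne']

/-- The upper bound for `S_t / t` given by testing with a multiple of a tent. -/
lemma Slevel_div_le {N n : ℕ} {p q : ℝ} (hp : 0 < p) (hq : 0 < q) {a : ZN N → ℝ}
    {A : ℝ} (ha : ∀ x, 0 ≤ a x) (hA : ∀ x, a x ≤ A) {V : ℝ} (hV : 0 < V)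
    (htent : vsum q (tent N n) = ENNReal.ofReal V) {t : ℝ} (ht : 0 < t) :
    Slevel p q a q t / ENNReal.ofReal t ≤ ENNReal.ofReal
      ((2 * n + 1) ^ N * 3 ^ N * (1 / p * (q / V) ^ (p / q) * t ^ (-(1 - p / q)) + A / V)) := by
  have hA0 : 0 ≤ A := (ha 0).trans (hA 0)
  set c : ℝ := (q * t / V) ^ (1 / q) with hc_def
  have hc : 0 ≤ c := by positivity
  have hcq : c ^ q = q * t / V := by
    rw [hc_def, ← Real.rpow_mul (by positivity), one_div_mul_cancel hq.ne', Real.rpow_one]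
  have hcp : c ^ p = (q / V) ^ (p / q) * t ^ (p / q) := by
    rw [hc_def, ← Real.rpow_mul (by positivity), ← Real.mul_rpow (by positivity) ht.le]
    congr 1
    · ring
    · ring
  have hS : Slevel p q a q t ≤ energy p q a (fun x => c * tent N n x) := by
    refine sInf_le ⟨_, ?_, ?_, rfl⟩
    · refine (box N n).finite_toSet.subset (subset_trans ?_ (support_tent_subset N n))
      exact fun x hx h => hx (by simp [h])
    · rw [vsum_const_mul hc, htent, ← ENNReal.ofReal_mul (by positivity), hcq,
        div_mul_cancel₀ _ hV.ne']
  have hE := hS.trans (energy_const_mul_tent_le (n := n) hp hq ha hA hc)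
  have hK : ((2 * n + 1) ^ N * 3 ^ N : ℝ≥0∞) = ENNReal.ofReal ((2 * n + 1) ^ N * 3 ^ N) := by
    have : ((2 * n + 1) ^ N * 3 ^ N : ℝ) = (((2 * n + 1) ^ N * 3 ^ N : ℕ) : ℝ) := by push_cast; rfl
    rw [this, ENNReal.ofReal_natCast]
    push_cast
    rfl
  rw [hK, ← ENNReal.ofReal_mul (by positivity)] at hE
  refine (ENNReal.div_le_div_right hE _).trans (le_of_eq ?_)
  rw [← ENNReal.ofReal_div_of_pos ht]
  congr 1
  rw [hcq, hcp, neg_sub, Real.rpow_sub_one ht.ne']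
  field_simp

/-- for `r = q > p*` and bounded weight `a`, `S_t / t → 0` as `t → +∞`. -/
theorem statement6 {N : ℕ} (hN : 2 ≤ N) (p q : ℝ) (hp : 1 < p) (hpN : p < (N : ℝ))
    (pstar : ℝ) (hpstar : pstar = (N : ℝ) * p / ((N : ℝ) - p))
    (hq : pstar < q)
    (a : ZN N → ℝ) (ha : ∀ x, 0 ≤ a x) (habd : ∃ A : ℝ, ∀ x, a x ≤ A) :
    Tendsto (fun t : ℝ => Slevel p q a q t / ENNReal.ofReal t) atTop (𝓝 0) := by
  have hN0 : (0 : ℝ) < (N : ℝ) - p := sub_pos.2 hpN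
  have hp0 : 0 < p := one_pos.trans hp
  have hpq : p < q := by
    refine lt_of_le_of_lt ?_ hq
    rw [hpstar, le_div_iff₀ hN0]
    nlinarith
  have hq0 : 0 < q := hp0.trans hpq
  obtain ⟨A, hA⟩ := habd
  have hA0 : 0 ≤ A := (ha 0).trans (hA 0)
  rw [ENNReal.tendsto_nhds_zero]
  intro ε hε
  obtain ⟨δ, hδ0, hδε⟩ := ENNReal.lt_iff_exists_nnreal_btwn.1 hε
  have hδ : (0 : ℝ) < δ := by exact_mod_cast hδ0
  have hlim : Tendsto (fun m : ℕ => 6 ^ N * A * (m : ℝ) ^ (-q)) atTop (𝓝 0) := by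
    simpa using ((tendsto_rpow_neg_atTop hq0).comp tendsto_natCast_atTop_atTop).const_mul
      (6 ^ N * A)
  obtain ⟨m, hmδ, hm⟩ := ((hlim.eventually_lt_const hδ).and (eventually_gt_atTop 0)).exists
  have hm0 : (0 : ℝ) < m := Nat.cast_pos.2 hm
  have hfin := vsum_ne_top hq0 (support_tent_subset N (2 * m))
  set V : ℝ := (vsum q (tent N (2 * m))).toReal with hV_def
  have hVle : (2 * m + 1) ^ N * (m : ℝ) ^ q ≤ V :=
    (ENNReal.ofReal_le_iff_le_toReal hfin).1 (le_vsum_tent N m hq0)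
  have hV : 0 < V := lt_of_lt_of_le (by positivity) hVle
  have hratio : (2 * (2 * m : ℕ) + 1) ^ N * 3 ^ N * (A / V) < (δ : ℝ) := by
    refine lt_of_le_of_lt ?_ hmδ
    calc (2 * (2 * m : ℕ) + 1) ^ N * 3 ^ N * (A / V)
        ≤ (2 * (2 * m + 1)) ^ N * 3 ^ N * (A / ((2 * m + 1) ^ N * (m : ℝ) ^ q)) := by
          gcongr
          push_cast
          linarith
      _ = 6 ^ N * A * (m : ℝ) ^ (-q) := by
          rw [mul_pow, Real.rpow_neg hm0.le, show (6 : ℝ) = 2 * 3 by norm_num, mul_pow]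
          field_simp
  have hbound : Tendsto (fun t : ℝ => (2 * (2 * m : ℕ) + 1) ^ N * 3 ^ N *
      (1 / p * (q / V) ^ (p / q) * t ^ (-(1 - p / q)) + A / V)) atTop
      (𝓝 ((2 * (2 * m : ℕ) + 1) ^ N * 3 ^ N * (A / V))) := by
    have h := tendsto_rpow_neg_atTop (sub_pos.2 ((div_lt_one hq0).2 hpq))
    simpa using ((h.const_mul (1 / p * (q / V) ^ (p / q))).add_const (A / V)).const_mul
      ((2 * (2 * m : ℕ) + 1) ^ N * 3 ^ N : ℝ)
  filter_upwards [hbound.eventually_lt_const hratio, eventually_gt_atTop 0] with t ht ht0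
  refine (Slevel_div_le hp0 hq0 ha hA hV (ENNReal.ofReal_toReal hfin).symm ht0).trans
    (le_trans ?_ hδε.le)
  rw [← ENNReal.ofReal_coe_nnreal]
  exact ENNReal.ofReal_le_ofReal ht.le
end
end

section
/- Let 1 < p < q < ∞. Then for every ε > 0 there exists δ ∈ (0,1) such that for all a ≥ 0 and all t₁, t₂ ≥ 0, either |t₁ − t₂| ≤ ε · max(t₁, t₂), or ((t₁+t₂)/2)^p + a·((t₁+t₂)/2)^q ≤ (1 − δ) · (t₁^p + a·t₁^q + t₂^p + a·t₂^q)/2. (That is, the double phase integrand H(a,t) = t^p + a t^q is uniformly convex, uniformly in the weight a.) -/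
/-- Uniform midpoint convexity of `s ↦ s ^ r` on the pairs `(1, s)` with `0 ≤ s ≤ c < 1`. -/
lemma exists_rpow_midpoint_one_le {r c : ℝ} (hr : 1 < r) (hc0 : 0 ≤ c) (hc : c < 1) :
    ∃ δ : ℝ, 0 < δ ∧ δ < 1 ∧ ∀ s ∈ Set.Icc 0 c,
      ((1 + s) / 2) ^ r ≤ (1 - δ) * ((1 + s ^ r) / 2) := by
  have hr0 : 0 < r := by linarith
  have hden : ∀ s ∈ Set.Icc 0 c, 0 < (1 + s ^ r) / 2 := fun s hs ↦ by
    have := Real.rpow_nonneg hs.1 r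
    positivity
  have hcont : ContinuousOn (fun s : ℝ ↦ ((1 + s) / 2) ^ r / ((1 + s ^ r) / 2))
      (Set.Icc 0 c) := by
    refine ContinuousOn.div ?_ ?_ fun s hs ↦ (hden s hs).ne'
    · exact ContinuousOn.rpow_const (by fun_prop) fun s _ ↦ Or.inr hr0.le
    · exact (continuousOn_const.add
        (continuousOn_id.rpow_const fun s _ ↦ Or.inr hr0.le)).div_const 2
  obtain ⟨m, hm, hmax⟩ := isCompact_Icc.exists_isMaxOn (Set.nonempty_Icc.2 hc0) hcont
  refine ⟨1 - ((1 + m) / 2) ^ r / ((1 + m ^ r) / 2), ?_, ?_, fun s hs ↦ ?_⟩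
  · rw [sub_pos, div_lt_one (hden m hm)]
    have h := (strictConvexOn_rpow hr).2 (Set.mem_Ici.2 zero_le_one) (Set.mem_Ici.2 hm.1)
      (hm.2.trans_lt hc).ne' (one_half_pos (α := ℝ)) one_half_pos (add_halves 1)
    simp only [smul_eq_mul, Real.one_rpow] at h
    rw [show (1 + m) / 2 = 1 / 2 * 1 + 1 / 2 * m by ring]
    linarith
  · have h1 : 0 < ((1 + m) / 2) ^ r := Real.rpow_pos_of_pos (by linarith [hm.1]) r
    linarith [div_pos h1 (hden m hm)]
  · rw [sub_sub_cancel, ← div_le_iff₀ (hden s hs)]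
    exact hmax hs

/-- Powers `t ↦ t ^ r` with `r > 1` are uniformly convex on `[0, ∞)`. -/
lemma exists_rpow_midpoint_le {r ε : ℝ} (hr : 1 < r) (hε : 0 < ε) :
    ∃ δ : ℝ, 0 < δ ∧ δ < 1 ∧ ∀ x y : ℝ, 0 ≤ x → 0 ≤ y → ε * max x y < |x - y| →
      ((x + y) / 2) ^ r ≤ (1 - δ) * ((x ^ r + y ^ r) / 2) := by
  obtain ⟨δ, h0, h1, h⟩ := exists_rpow_midpoint_one_le (c := max 0 (1 - ε)) hr
    (le_max_left _ _) (max_lt one_pos (by linarith))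
  refine ⟨δ, h0, h1, fun x y hx hy hxy ↦ ?_⟩
  wlog hle : y ≤ x generalizing x y
  · have := this y x hy hx (by rwa [max_comm, abs_sub_comm]) (le_of_not_ge hle)
    rwa [add_comm x y, add_comm (x ^ r)]
  rw [max_eq_left hle, abs_of_nonneg (sub_nonneg.2 hle)] at hxy
  have hx0 : 0 < x := hx.lt_of_ne (by rintro rfl; linarith)
  have hs := h (y / x) ⟨by positivity, le_max_of_le_right
    ((div_le_iff₀ hx0).2 (by linarith))⟩
  have key := mul_le_mul_of_nonneg_left hs (Real.rpow_nonneg hx r)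
  have e : y ^ r = x ^ r * (y / x) ^ r := by
    rw [← Real.mul_rpow hx (by positivity), mul_div_cancel₀ _ hx0.ne']
  have e' : ((x + y) / 2) ^ r = x ^ r * ((1 + y / x) / 2) ^ r := by
    rw [← Real.mul_rpow hx (by positivity)]
    congr 1
    field_simp
  rw [e, e']
  linarith

/-- uniform convexity of the double phase integrand `H(a,t) = t^p + a t^q`,
uniformly in the weight `a ≥ 0`. -/
theorem statement8 (p q : ℝ) (hp : 1 < p) (hpq : p < q) :
    ∀ ε : ℝ, 0 < ε → ∃ δ : ℝ, 0 < δ ∧ δ < 1 ∧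
      ∀ a : ℝ, 0 ≤ a → ∀ t₁ t₂ : ℝ, 0 ≤ t₁ → 0 ≤ t₂ →
        |t₁ - t₂| ≤ ε * max t₁ t₂ ∨
        ((t₁ + t₂) / 2) ^ p + a * ((t₁ + t₂) / 2) ^ q ≤
          (1 - δ) * ((t₁ ^ p + a * t₁ ^ q + t₂ ^ p + a * t₂ ^ q) / 2) := by
  intro ε hε
  obtain ⟨δ₁, h₁, h₁', H₁⟩ := exists_rpow_midpoint_le hp hε
  obtain ⟨δ₂, h₂, -, H₂⟩ := exists_rpow_midpoint_le (hp.trans hpq) hε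
  refine ⟨min δ₁ δ₂, lt_min h₁ h₂, min_lt_of_left_lt h₁', fun a ha x y hx hy ↦ ?_⟩
  refine or_iff_not_imp_left.2 fun hxy ↦ ?_
  rw [not_le] at hxy
  have hP : ((x + y) / 2) ^ p ≤ (1 - min δ₁ δ₂) * ((x ^ p + y ^ p) / 2) :=
    (H₁ x y hx hy hxy).trans <| by gcongr; exact min_le_left _ _
  have hQ : ((x + y) / 2) ^ q ≤ (1 - min δ₁ δ₂) * ((x ^ q + y ^ q) / 2) :=
    (H₂ x y hx hy hxy).trans <| by gcongr; exact min_le_right _ _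
  linarith [mul_le_mul_of_nonneg_left hQ ha]
end

section
/- Let (V, w, μ) be a locally finite weighted graph, 1 < p < q < ∞, a : V → [0,∞), and let u, v : V → ℝ satisfy ρ(∇u) < ∞ and ρ(∇v) ≤ 1. Then the series defining ⟨L(u), v⟩ := (1/2) Σ_{(x,y): w(x,y)>0} w(x,y) (|∇u(x,y)|^{p−2}∇u(x,y)∇v(x,y) + a(x)|∇u(x,y)|^{q−2}∇u(x,y)∇v(x,y)) converges absolutely, and |⟨L(u), v⟩| ≤ ρ(∇u)^{(p−1)/p} + ρ(∇u)^{(q−1)/q}. -/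
open scoped ENNReal Classical

noncomputable section

/-- The flux `f(x,y) = |∇u(x,y)|^{p−2}∇u(x,y) + a(x)|∇u(x,y)|^{q−2}∇u(x,y)`
of the double phase operator. -/
def dpFlux {V : Type*} (p q : ℝ) (a u : V → ℝ) (x y : V) : ℝ :=
  |u y - u x| ^ (p - 2) * (u y - u x) + a x * (|u y - u x| ^ (q - 2) * (u y - u x))

/-- The gradient modular `ρ(∇u) = (1/2) Σ_{w(x,y)>0} w(x,y)(|∇u|^p + a(x)|∇u|^q)`. -/
def rhoGrad {V : Type*} (w : V → V → ℝ) (p q : ℝ) (a u : V → ℝ) : ℝ≥0∞ :=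
  (∑' e : V × V,
      if 0 < w e.1 e.2 then
        ENNReal.ofReal (w e.1 e.2 * (|u e.2 - u e.1| ^ p + a e.1 * |u e.2 - u e.1| ^ q))
      else 0) / 2

/-- Hölder's inequality with weights `c` for the pairing of the `r`-flux `|g|^{r−2} g` with `h`,
when the `r`-energy of `h` is at most `1`. -/
theorem summable_and_abs_tsum_rpow_flux_le {ι : Type*} {c g h : ι → ℝ} {r A : ℝ} (hr : 1 < r)
    (hc : ∀ i, 0 ≤ c i)
    (hg : Summable fun i => c i * |g i| ^ r) (hh : Summable fun i => c i * |h i| ^ r)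
    (hgA : ∑' i, c i * |g i| ^ r ≤ A) (hh1 : ∑' i, c i * |h i| ^ r ≤ 1) :
    (Summable fun i => c i * (|g i| ^ (r - 2) * g i * h i)) ∧
      |∑' i, c i * (|g i| ^ (r - 2) * g i * h i)| ≤ A ^ ((r - 1) / r) := by
  have hr0 : 0 < r := by linarith
  have hr1 : 0 < r - 1 := by linarith
  have hconj : (r / (r - 1)).HolderConjugate r := (Real.HolderConjugate.conjExponent hr).symm
  have hf_pow (i : ι) :
      (c i ^ ((r - 1) / r) * |g i| ^ (r - 1)) ^ (r / (r - 1)) = c i * |g i| ^ r := by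
    rw [Real.mul_rpow (Real.rpow_nonneg (hc i) _) (by positivity), ← Real.rpow_mul (hc i),
      ← Real.rpow_mul (abs_nonneg _), show (r - 1) / r * (r / (r - 1)) = 1 by field_simp,
      show (r - 1) * (r / (r - 1)) = r by field_simp, Real.rpow_one]
  have hh_pow (i : ι) : (c i ^ (1 / r) * |h i|) ^ r = c i * |h i| ^ r := by
    rw [Real.mul_rpow (Real.rpow_nonneg (hc i) _) (abs_nonneg _), ← Real.rpow_mul (hc i),
      show 1 / r * r = 1 by field_simp, Real.rpow_one]
  have hprod (i : ι) : c i ^ ((r - 1) / r) * |g i| ^ (r - 1) * (c i ^ (1 / r) * |h i|) =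
      |c i * (|g i| ^ (r - 2) * g i * h i)| := by
    have hflux : |g i| ^ (r - 2) * |g i| = |g i| ^ (r - 1) := by
      rw [← Real.rpow_add_one' (abs_nonneg _) (by linarith)]
      ring_nf
    have hweight : c i ^ ((r - 1) / r) * c i ^ (1 / r) = c i := by
      have hsum : (r - 1) / r + 1 / r = 1 := by field_simp; ring
      rw [← Real.rpow_add' (hc i) (by rw [hsum]; exact one_ne_zero), hsum, Real.rpow_one]
    rw [abs_mul, abs_mul, abs_mul, abs_of_nonneg (hc i),
      abs_of_nonneg (Real.rpow_nonneg (abs_nonneg (g i)) _), hflux]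
    linear_combination (|g i| ^ (r - 1) * |h i|) * hweight
  obtain ⟨hsum, hle⟩ := Real.summable_and_inner_le_Lp_mul_Lq_tsum_of_nonneg hconj
    (f := fun i => c i ^ ((r - 1) / r) * |g i| ^ (r - 1)) (g := fun i => c i ^ (1 / r) * |h i|)
    (fun i => mul_nonneg (Real.rpow_nonneg (hc i) _) (by positivity))
    (fun i => mul_nonneg (Real.rpow_nonneg (hc i) _) (abs_nonneg _))
    (by simpa only [hf_pow] using hg) (by simpa only [hh_pow] using hh)
  simp only [hf_pow, hh_pow, hprod, one_div_div] at hsum hle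
  have habs : |∑' i, c i * (|g i| ^ (r - 2) * g i * h i)| ≤
      ∑' i, |c i * (|g i| ^ (r - 2) * g i * h i)| := by
    simp only [← Real.norm_eq_abs (c _ * _), ← Real.norm_eq_abs (∑' _, _)] at hsum ⊢
    exact norm_tsum_le_tsum_norm hsum
  refine ⟨hsum.of_abs, habs.trans (hle.trans ?_)⟩
  have hg0 : 0 ≤ ∑' i, c i * |g i| ^ r :=
    tsum_nonneg fun i => mul_nonneg (hc i) (by positivity)
  have hh0 : 0 ≤ ∑' i, c i * |h i| ^ r :=
    tsum_nonneg fun i => mul_nonneg (hc i) (by positivity)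
  calc _ ≤ (∑' i, c i * |g i| ^ r) ^ ((r - 1) / r) * 1 := by
        gcongr
        exact Real.rpow_le_one hh0 hh1 (by positivity)
    _ ≤ A ^ ((r - 1) / r) := by
        rw [mul_one]
        gcongr

/-- Finiteness of the gradient modular gives `HasSum` of its real-valued series. -/
theorem hasSum_rhoGrad_toReal {V : Type*} {w : V → V → ℝ} {p q : ℝ} {a u : V → ℝ}
    (hw0 : ∀ x y, 0 ≤ w x y) (ha : ∀ x, 0 ≤ a x) (hu : rhoGrad w p q a u ≠ ⊤) :
    HasSum (fun e : V × V =>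
      w e.1 e.2 / 2 * (|u e.2 - u e.1| ^ p + a e.1 * |u e.2 - u e.1| ^ q))
      (rhoGrad w p q a u).toReal := by
  have hterm (e : V × V) : (if 0 < w e.1 e.2 then
        ENNReal.ofReal (w e.1 e.2 * (|u e.2 - u e.1| ^ p + a e.1 * |u e.2 - u e.1| ^ q))
      else 0) =
      ENNReal.ofReal (w e.1 e.2 * (|u e.2 - u e.1| ^ p + a e.1 * |u e.2 - u e.1| ^ q)) := by
    split_ifs with h
    · rfl
    · simp [le_antisymm (not_lt.mp h) (hw0 _ _)]
  have hnonneg (e : V × V) :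
      0 ≤ w e.1 e.2 * (|u e.2 - u e.1| ^ p + a e.1 * |u e.2 - u e.1| ^ q) :=
    mul_nonneg (hw0 _ _) (add_nonneg (by positivity) (mul_nonneg (ha _) (by positivity)))
  simp only [rhoGrad, hterm] at hu ⊢
  have hfin : ∑' e : V × V, ENNReal.ofReal
      (w e.1 e.2 * (|u e.2 - u e.1| ^ p + a e.1 * |u e.2 - u e.1| ^ q)) ≠ ⊤ := by
    intro htop
    exact hu (by rw [htop]; exact ENNReal.top_div_of_ne_top (by simp))
  have hsum := (ENNReal.hasSum_toReal hfin).div_const 2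
  simp only [ENNReal.toReal_ofReal (hnonneg _)] at hsum
  rw [ENNReal.toReal_div, ENNReal.tsum_toReal_eq fun _ => ENNReal.ofReal_ne_top]
  simp only [ENNReal.toReal_ofReal (hnonneg _)]
  simp only [mul_div_right_comm, ENNReal.toReal_ofNat] at hsum ⊢
  exact hsum

/-- Each of the two parts of a finite gradient modular is summable and bounded by it. -/
theorem rhoGrad_parts {V : Type*} {w : V → V → ℝ} {p q : ℝ} {a u : V → ℝ}
    (hw0 : ∀ x y, 0 ≤ w x y) (ha : ∀ x, 0 ≤ a x) (hu : rhoGrad w p q a u ≠ ⊤) :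
    ((Summable fun e : V × V => w e.1 e.2 / 2 * |u e.2 - u e.1| ^ p) ∧
      ∑' e : V × V, w e.1 e.2 / 2 * |u e.2 - u e.1| ^ p ≤ (rhoGrad w p q a u).toReal) ∧
    ((Summable fun e : V × V => w e.1 e.2 / 2 * a e.1 * |u e.2 - u e.1| ^ q) ∧
      ∑' e : V × V, w e.1 e.2 / 2 * a e.1 * |u e.2 - u e.1| ^ q ≤
        (rhoGrad w p q a u).toReal) := by
  have hsum := hasSum_rhoGrad_toReal hw0 ha hu
  have hp0 (e : V × V) : 0 ≤ w e.1 e.2 / 2 * |u e.2 - u e.1| ^ p :=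
    mul_nonneg (div_nonneg (hw0 _ _) zero_le_two) (by positivity)
  have hq0 (e : V × V) : 0 ≤ w e.1 e.2 / 2 * a e.1 * |u e.2 - u e.1| ^ q :=
    mul_nonneg (mul_nonneg (div_nonneg (hw0 _ _) zero_le_two) (ha _)) (by positivity)
  simp only [mul_add, ← mul_assoc] at hsum
  have hps : Summable fun e : V × V => w e.1 e.2 / 2 * |u e.2 - u e.1| ^ p :=
    hsum.summable.of_nonneg_of_le hp0 fun e => le_add_of_nonneg_right (hq0 e)
  have hqs : Summable fun e : V × V => w e.1 e.2 / 2 * a e.1 * |u e.2 - u e.1| ^ q :=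
    hsum.summable.of_nonneg_of_le hq0 fun e => le_add_of_nonneg_left (hp0 e)
  rw [← hsum.tsum_eq, hps.tsum_add hqs]
  exact ⟨⟨hps, le_add_of_nonneg_right (tsum_nonneg hq0)⟩,
    ⟨hqs, le_add_of_nonneg_left (tsum_nonneg hp0)⟩⟩

/-- boundedness of the double phase operator: if `ρ(∇u) < ∞` and
`ρ(∇v) ≤ 1`, the series defining `⟨L(u), v⟩` converges absolutely and
`|⟨L(u), v⟩| ≤ ρ(∇u)^{(p−1)/p} + ρ(∇u)^{(q−1)/q}`. -/
theorem statement13 {V : Type*} [Countable V] (w : V → V → ℝ) (μ : V → ℝ)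
    (hw0 : ∀ x y, 0 ≤ w x y) (hwsym : ∀ x y, w x y = w y x)
    (hloc : ∀ x, {y | 0 < w x y}.Finite) (hμ : ∀ x, 0 < μ x)
    (p q : ℝ) (hp : 1 < p) (hpq : p < q)
    (a : V → ℝ) (ha : ∀ x, 0 ≤ a x)
    (u v : V → ℝ) (hu : rhoGrad w p q a u < ⊤) (hv : rhoGrad w p q a v ≤ 1) :
    Summable (fun e : V × V =>
      |if 0 < w e.1 e.2 then
          w e.1 e.2 * (dpFlux p q a u e.1 e.2 * (v e.2 - v e.1)) else 0|) ∧
    |(1 / 2 : ℝ) * ∑' e : V × V,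
        (if 0 < w e.1 e.2 then
          w e.1 e.2 * (dpFlux p q a u e.1 e.2 * (v e.2 - v e.1)) else 0)| ≤
      (rhoGrad w p q a u).toReal ^ ((p - 1) / p) +
        (rhoGrad w p q a u).toReal ^ ((q - 1) / q) := by
  have hv_top : rhoGrad w p q a v ≠ ⊤ := ne_top_of_le_ne_top ENNReal.one_ne_top hv
  have hv_real : (rhoGrad w p q a v).toReal ≤ 1 := by
    simpa using ENNReal.toReal_mono ENNReal.one_ne_top hv
  obtain ⟨⟨hup, hup_le⟩, huq, huq_le⟩ := rhoGrad_parts hw0 ha hu.ne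
  obtain ⟨⟨hvp, hvp_le⟩, hvq, hvq_le⟩ := rhoGrad_parts hw0 ha hv_top
  obtain ⟨hPs, hP⟩ := summable_and_abs_tsum_rpow_flux_le (c := fun e : V × V => w e.1 e.2 / 2)
    (g := fun e => u e.2 - u e.1) (h := fun e => v e.2 - v e.1) hp
    (fun e : V × V => div_nonneg (hw0 e.1 e.2) zero_le_two) hup hvp hup_le (hvp_le.trans hv_real)
  obtain ⟨hQs, hQ⟩ := summable_and_abs_tsum_rpow_flux_le (c := fun e : V × V => w e.1 e.2 / 2 * a e.1)
    (g := fun e => u e.2 - u e.1) (h := fun e => v e.2 - v e.1) (hp.trans hpq)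
    (fun e : V × V => mul_nonneg (div_nonneg (hw0 e.1 e.2) zero_le_two) (ha e.1))
    huq hvq huq_le (hvq_le.trans hv_real)
  have hterm (e : V × V) : (if 0 < w e.1 e.2 then
      w e.1 e.2 * (dpFlux p q a u e.1 e.2 * (v e.2 - v e.1)) else 0) =
      2 * (w e.1 e.2 / 2 * (|u e.2 - u e.1| ^ (p - 2) * (u e.2 - u e.1) * (v e.2 - v e.1)) +
        w e.1 e.2 / 2 * a e.1 *
          (|u e.2 - u e.1| ^ (q - 2) * (u e.2 - u e.1) * (v e.2 - v e.1))) := by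
    split_ifs with h
    · rw [dpFlux]
      ring
    · simp [le_antisymm (not_lt.mp h) (hw0 _ _)]
  simp only [hterm]
  refine ⟨((hPs.add hQs).mul_left 2).abs, ?_⟩
  rw [tsum_mul_left, ← mul_assoc, one_div_mul_cancel two_ne_zero, one_mul,
    hPs.tsum_add hQs]
  exact (abs_add_le _ _).trans (add_le_add hP hQ)
end
end
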